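/- Let ω > 0. There is a constant C > 0 such that every (u,v) ∈ H¹×H¹ \ {(0,0)} with K_ω(u,v) = 0 satisfies P(u,v) ≥ √(1/C) > 0; i.e., the functional P has a uniform positive lower bound on the Nehari manifold {K_ω = 0} \ {(0,0)}. -/

import Mathlib

open MeasureTheory Complex Filter
open scoped ENNReal NNReal

noncomputable section

abbrev E5 := EuclideanSpace ℝ (Fin 5)

/-- Membership in `H¹(ℝ⁵, ℂ)`: `u ∈ L²` with (weak) gradient in `L²`. -/
def InH1 (u : E5 → ℂ) : Prop :=
  MemLp u 2 (volume : Measure E5) ∧ Differentiable ℝ u ∧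
    MemLp (fun x => fderiv ℝ u x) 2 (volume : Measure E5)

/-- Squared `H¹` norm. -/
def H1normSq (u : E5 → ℂ) : ℝ :=
  (∫ x : E5, ‖u x‖ ^ 2) + ∫ x : E5, ‖fderiv ℝ u x‖ ^ 2

/-- The kinetic functional `K(u,v) = ‖∇u‖² + (1/2)‖∇v‖²`. -/
def Kin (u v : E5 → ℂ) : ℝ :=
  (∫ x : E5, ‖fderiv ℝ u x‖ ^ 2) + (1 / 2) * ∫ x : E5, ‖fderiv ℝ v x‖ ^ 2

/-- The mass functional `M(u,v) = ‖u‖² + 2‖v‖²`. -/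
def Mass (u v : E5 → ℂ) : ℝ :=
  (∫ x : E5, ‖u x‖ ^ 2) + 2 * ∫ x : E5, ‖v x‖ ^ 2

/-- The interaction functional `P(u,v) = Re ∫ conj v · u²`. -/
def Pot (u v : E5 → ℂ) : ℝ :=
  ∫ x : E5, ((starRingEnd ℂ) (v x) * (u x) ^ 2).re

/-- The action functional `S_ω`. -/
def Sfun (ω : ℝ) (u v : E5 → ℂ) : ℝ :=
  (1 / 2) * Kin u v + (ω / 2) * Mass u v - Pot u v

/-- The Nehari functional `K_ω`. -/
def Nehari (ω : ℝ) (u v : E5 → ℂ) : ℝ :=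
  Kin u v + ω * Mass u v - 3 * Pot u v

/-- The energy `E(u,v) = (1/2)K(u,v) − P(u,v)`. -/
def Efun (u v : E5 → ℂ) : ℝ := (1 / 2) * Kin u v - Pot u v

/-- The virial functional `Q(u,v) = K(u,v) − (5/2)P(u,v)`. -/
def Qfun (u v : E5 → ℂ) : ℝ := Kin u v - (5 / 2) * Pot u v

/-- Nontriviality of a pair. -/
def Nontriv2 (u v : E5 → ℂ) : Prop := ¬(u = 0 ∧ v = 0)

/-- The infimum `d(ω)` of `S_ω` on the Nehari manifold. -/
def dmin (ω : ℝ) : ℝ :=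
  sInf {s : ℝ | ∃ u v : E5 → ℂ, InH1 u ∧ InH1 v ∧ Nontriv2 u v ∧
    Nehari ω u v = 0 ∧ s = Sfun ω u v}

/-- Laplacian of a complex-valued function on `ℝ⁵`. -/
def lap (u : E5 → ℂ) (x : E5) : ℂ :=
  ∑ i : Fin 5,
    fderiv ℝ (fun y => fderiv ℝ u y (EuclideanSpace.single i (1 : ℝ))) x
      (EuclideanSpace.single i (1 : ℝ))

/-- `(φ,ψ)` is an `H¹` solution of the elliptic system
`−Δφ + ωφ = 2ψ conj φ`, `−(1/2)Δψ + 2ωψ = φ²`. -/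
def IsEllSol (ω : ℝ) (φ ψ : E5 → ℂ) : Prop :=
  InH1 φ ∧ InH1 ψ ∧
  (∀ x, -lap φ x + (ω : ℂ) * φ x = 2 * ψ x * (starRingEnd ℂ) (φ x)) ∧
  (∀ x, -(1 / 2 : ℂ) * lap ψ x + (2 * ω : ℂ) * ψ x = (φ x) ^ 2)

/-- A ground state: a nontrivial solution of the elliptic system minimizing
`S_ω` among all nontrivial solutions. -/
def IsGroundState (ω : ℝ) (φ ψ : E5 → ℂ) : Prop :=
  IsEllSol ω φ ψ ∧ Nontriv2 φ ψ ∧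
    ∀ u v : E5 → ℂ, IsEllSol ω u v → Nontriv2 u v → Sfun ω φ ψ ≤ Sfun ω u v

/-- The `L²`-invariant scaling `u^γ(x) = γ^{5/2} u(γ x)`. -/
def scaleFn (γ : ℝ) (u : E5 → ℂ) : E5 → ℂ :=
  fun x => ((γ ^ ((5 : ℝ) / 2) : ℝ) : ℂ) * u (γ • x)

/-- Finite variance. -/
def FinVar (u : E5 → ℂ) : Prop :=
  Integrable (fun x : E5 => ‖x‖ ^ 2 * ‖u x‖ ^ 2) (volume : Measure E5)

/-- `(u,v)` solves the evolution system `i∂_t u + Δu = −2v conj u`,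
`i∂_t v + (1/2)Δv = −u²` on the time set `I`, staying in `H¹ × H¹`. -/
def IsEvolSol (u v : ℝ → E5 → ℂ) (I : Set ℝ) : Prop :=
  (∀ t ∈ I, InH1 (u t) ∧ InH1 (v t)) ∧
  (∀ t ∈ I, ∀ x : E5,
    Complex.I * deriv (fun s => u s x) t + lap (u t) x
      = -2 * v t x * (starRingEnd ℂ) (u t x)) ∧
  (∀ t ∈ I, ∀ x : E5,
    Complex.I * deriv (fun s => v s x) t + (1 / 2 : ℂ) * lap (v t) x
      = -(u t x) ^ 2)

/-- The time set `[0, T)` for `T : ℝ≥0∞`. -/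
def timeSet (T : ℝ≥0∞) : Set ℝ := {t : ℝ | 0 ≤ t ∧ ENNReal.ofReal t < T}

/-- Conservation of mass and energy on a time set. -/
def Conserves (u v : ℝ → E5 → ℂ) (I : Set ℝ) : Prop :=
  (∀ t ∈ I, Mass (u t) (v t) = Mass (u 0) (v 0)) ∧
  (∀ t ∈ I, Efun (u t) (v t) = Efun (u 0) (v 0))

/-- Membership in the blow-up set `ℬ_ω` associated with a ground state `(φ,ψ)`. -/
def InBset (ω : ℝ) (φ ψ u v : E5 → ℂ) : Prop :=
  InH1 u ∧ InH1 v ∧ Nontriv2 u v ∧ Sfun ω u v < Sfun ω φ ψ ∧ Qfun u v < 0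

/-- A maximal solution of the evolution system on `[0,T)` with given data,
conserving mass and energy. -/
def IsMaximalSol (u v : ℝ → E5 → ℂ) (T : ℝ≥0∞) (u₀ v₀ : E5 → ℂ) : Prop :=
  0 < T ∧ u 0 = u₀ ∧ v 0 = v₀ ∧ IsEvolSol u v (timeSet T) ∧
    Conserves u v (timeSet T) ∧
    ∀ (u' v' : ℝ → E5 → ℂ) (T' : ℝ≥0∞),
      IsEvolSol u' v' (timeSet T') → Conserves u' v' (timeSet T') →
      (∀ t ∈ timeSet T, u' t = u t ∧ v' t = v t) → u' 0 = u₀ → v' 0 = v₀ →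
        T' ≤ T

/-- Blow-up in finite time: the maximal time is finite and the `H¹ × H¹` norm
tends to infinity as `t` approaches it from below. -/
def BlowsUp (u v : ℝ → E5 → ℂ) (T : ℝ≥0∞) : Prop :=
  T ≠ ⊤ ∧ Tendsto (fun t : ℝ => Real.sqrt (H1normSq (u t) + H1normSq (v t)))
    (nhdsWithin T.toReal (Set.Iio T.toReal)) atTop

end

open MeasureTheory Complex Filter
open scoped ENNReal

theorem enorm_le_lintegral_enorm_deriv_of_hasCompactSupport {f : ℝ → ℝ}
    (hf : Differentiable ℝ f) (hs : HasCompactSupport f) (t : ℝ) :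
    ‖f t‖ₑ ≤ ∫⁻ s, ‖deriv f s‖ₑ := by
  by_cases htop : ∫⁻ s, ‖deriv f s‖ₑ = ⊤
  · simp [htop]
  have hint : Integrable (deriv f) :=
    ⟨(measurable_deriv f).aestronglyMeasurable, lt_top_iff_ne_top.2 htop⟩
  have hlim : Tendsto f atBot (nhds 0) := by
    rw [hasCompactSupport_iff_eventuallyEq, Filter.coclosedCompact_eq_cocompact] at hs
    exact (hs.filter_mono _root_.atBot_le_cocompact).tendsto
  have key := integral_Iic_of_hasDerivAt_of_tendsto' (a := t)
    (fun x _ => (hf x).hasDerivAt) hint.integrableOn hlim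
  rw [sub_zero] at key
  rw [← key]
  exact (enorm_integral_le_lintegral_enorm _).trans (setLIntegral_le_lintegral _ _)

theorem lintegral_rpow_le_lintegral_fderiv_rpow {w : E5 → ℝ}
    (hw : Differentiable ℝ w) (hs : HasCompactSupport w) :
    ∫⁻ x, ‖w x‖ₑ ^ (5 / 4 : ℝ) ≤ (∫⁻ x, ‖fderiv ℝ w x‖ₑ) ^ (5 / 4 : ℝ) := by
  have hp : Real.HolderConjugate (Fintype.card (Fin 5)) (5 / 4 : ℝ) := by
    rw [Real.holderConjugate_iff]; norm_num
  have hmp := PiLp.volume_preserving_toLp (Fin 5)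
  have hemb : MeasurableEmbedding (WithLp.toLp 2 : (Fin 5 → ℝ) → E5) :=
    (MeasurableEquiv.toLp 2 (Fin 5 → ℝ)).measurableEmbedding
  rw [← hmp.lintegral_comp_emb hemb, ← hmp.lintegral_comp_emb hemb]
  have hmeas : Measurable fun x : Fin 5 → ℝ => ‖fderiv ℝ w (WithLp.toLp 2 x)‖ₑ :=
    ((measurable_fderiv ℝ w).comp hemb.measurable).enorm
  refine le_trans ?_ (lintegral_prod_lintegral_pow_le (fun _ => volume) hp hmeas)
  refine lintegral_mono fun x => ?_
  have hprod : ‖w (WithLp.toLp 2 x)‖ₑ ^ (5 / 4 : ℝ) =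
      ∏ _i : Fin 5, ‖w (WithLp.toLp 2 x)‖ₑ ^ ((1 : ℝ) / ((Fintype.card (Fin 5) : ℝ) - 1)) := by
    rw [Finset.prod_const, ← ENNReal.rpow_natCast, ← ENNReal.rpow_mul]
    norm_num
  beta_reduce
  rw [hprod]
  gcongr with i
  · norm_num
  have hline : ∀ s, HasDerivAt (fun s => (WithLp.toLp 2 (Function.update x i s) : E5))
      (EuclideanSpace.single i (1 : ℝ)) s := fun s => by
    have := ((PiLp.continuousLinearEquiv 2 ℝ (fun _ : Fin 5 => ℝ)).symm
      : (Fin 5 → ℝ) →L[ℝ] E5).hasFDerivAt.comp_hasDerivAt s (hasDerivAt_update x i s)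
    exact this
  have hder : ∀ s, HasDerivAt (fun s => w (WithLp.toLp 2 (Function.update x i s)))
      (fderiv ℝ w (WithLp.toLp 2 (Function.update x i s)) (EuclideanSpace.single i (1 : ℝ))) s :=
    fun s => (hw _).hasFDerivAt.comp_hasDerivAt s (hline s)
  have hcs : HasCompactSupport fun s => w (WithLp.toLp 2 (Function.update x i s)) :=
    hs.comp_isClosedEmbedding
      ((PiLp.homeomorph 2 (fun _ : Fin 5 => ℝ)).symm.isClosedEmbedding.comp
        (isClosedEmbedding_update x i))
  have h := enorm_le_lintegral_enorm_deriv_of_hasCompactSupport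
    (fun s => (hder s).differentiableAt) hcs (x i)
  rw [Function.update_eq_self] at h
  refine h.trans (lintegral_mono fun s => ?_)
  rw [(hder s).deriv]
  refine (ContinuousLinearMap.le_opENorm _ _).trans ?_
  rw [← ofReal_norm (EuclideanSpace.single i (1 : ℝ))]
  simp

/-- The critical Sobolev inequality `‖u‖_{10/3} ≤ (8/3) ‖∇u‖_2`, raised to the power `5/2`. -/
theorem sobolev_of_hasCompactSupport {u : E5 → ℂ}
    (hu : Differentiable ℝ u) (hs : HasCompactSupport u) :
    (∫⁻ x, ‖u x‖ₑ ^ (10 / 3 : ℝ)) ^ (3 / 4 : ℝ) ≤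
      ENNReal.ofReal (8 / 3) ^ (5 / 2 : ℝ) * (∫⁻ x, ‖fderiv ℝ u x‖ₑ ^ (2 : ℝ)) ^ (5 / 4 : ℝ) := by
  set X := ∫⁻ x, ‖u x‖ₑ ^ (10 / 3 : ℝ) with hX
  set D := ∫⁻ x, ‖fderiv ℝ u x‖ₑ ^ (2 : ℝ) with hD
  have hXtop : X ≠ ⊤ := by
    have h := (hu.continuous.memLp_of_hasCompactSupport (μ := volume)
      (p := ((10 / 3 : ℝ≥0) : ℝ≥0∞)) hs).eLpNorm_lt_top
    rw [eLpNorm_nnreal_eq_eLpNorm' (by norm_num)] at h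
    simpa [hX] using (lintegral_rpow_enorm_lt_top_of_eLpNorm'_lt_top (by norm_num) h).ne
  rcases eq_or_ne X 0 with h0 | h0
  · rw [h0, ENNReal.zero_rpow_of_pos (by norm_num)]; exact zero_le
  have h83 : (1 : ℝ) < 8 / 3 := by norm_num
  have hgn := lintegral_rpow_le_lintegral_fderiv_rpow (hu.norm_rpow h83)
    (hs.norm.rpow_const (by norm_num : (8 / 3 : ℝ) ≠ 0))
  have hL : ∫⁻ x, ‖‖u x‖ ^ (8 / 3 : ℝ)‖ₑ ^ (5 / 4 : ℝ) = X := by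
    refine lintegral_congr fun x => ?_
    rw [Real.enorm_rpow_of_nonneg (norm_nonneg _) (by norm_num), enorm_norm, ← ENNReal.rpow_mul]
    norm_num
  have hmu : Measurable fun x => ‖u x‖ₑ := hu.continuous.measurable.enorm
  have hmd : Measurable fun x => ‖fderiv ℝ u x‖ₑ := (measurable_fderiv ℝ u).enorm
  have hR : ∫⁻ x, ‖fderiv ℝ (fun x => ‖u x‖ ^ (8 / 3 : ℝ)) x‖ₑ ≤
      ENNReal.ofReal (8 / 3) * (X ^ (1 / 2 : ℝ) * D ^ (1 / 2 : ℝ)) := by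
    calc ∫⁻ x, ‖fderiv ℝ (fun x => ‖u x‖ ^ (8 / 3 : ℝ)) x‖ₑ
        ≤ ∫⁻ x, ENNReal.ofReal (8 / 3) * (‖u x‖ₑ ^ (5 / 3 : ℝ) * ‖fderiv ℝ u x‖ₑ) := by
          refine lintegral_mono fun x => ?_
          have h := ENNReal.ofReal_le_ofReal (norm_fderiv_norm_rpow_le hu (x := x) h83)
          rw [ofReal_norm, ENNReal.ofReal_mul (by positivity), ENNReal.ofReal_mul (by norm_num),
            ofReal_norm, ← ENNReal.ofReal_rpow_of_nonneg (norm_nonneg _) (by norm_num),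
            ofReal_norm, mul_assoc] at h
          norm_num at h ⊢
          exact h
      _ = ENNReal.ofReal (8 / 3) * ∫⁻ x, ‖u x‖ₑ ^ (5 / 3 : ℝ) * ‖fderiv ℝ u x‖ₑ :=
          lintegral_const_mul _ ((hmu.pow_const _).mul hmd)
      _ ≤ _ := by
          gcongr
          refine (ENNReal.lintegral_mul_le_Lp_mul_Lq volume Real.HolderConjugate.two_two
            (hmu.pow_const (5 / 3 : ℝ)).aemeasurable hmd.aemeasurable).trans_eq ?_
          simp_rw [← ENNReal.rpow_mul]
          norm_num [hX, hD]
  have hmain : X ≤ (ENNReal.ofReal (8 / 3) * (X ^ (1 / 2 : ℝ) * D ^ (1 / 2 : ℝ))) ^ (5 / 4 : ℝ) := by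
    calc X = _ := hL.symm
      _ ≤ _ := hgn
      _ ≤ _ := by gcongr
  have h2 : X ^ (5 / 4 : ℝ) * X ^ (3 / 4 : ℝ) ≤ X ^ (5 / 4 : ℝ) *
      (ENNReal.ofReal (8 / 3) ^ (5 / 2 : ℝ) * D ^ (5 / 4 : ℝ)) := by
    have h3 := ENNReal.rpow_le_rpow hmain (by norm_num : (0 : ℝ) ≤ 2)
    rw [← ENNReal.rpow_mul, ENNReal.mul_rpow_of_nonneg _ _ (by norm_num),
      ENNReal.mul_rpow_of_nonneg _ _ (by norm_num), ← ENNReal.rpow_mul, ← ENNReal.rpow_mul] at h3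
    rw [← ENNReal.rpow_add _ _ h0 hXtop]
    norm_num at h3 ⊢
    rw [mul_left_comm]
    exact h3
  exact (ENNReal.mul_le_mul_iff_right (by simp [h0, hXtop]) (by finiteness)).1 h2

theorem lintegral_cube_le_of_hasCompactSupport {u : E5 → ℂ}
    (hu : Differentiable ℝ u) (hs : HasCompactSupport u) :
    ∫⁻ x, ‖u x‖ₑ ^ (3 : ℝ) ≤ ENNReal.ofReal (8 / 3) ^ (5 / 2 : ℝ) *
      ((∫⁻ x, ‖u x‖ₑ ^ (2 : ℝ)) + ∫⁻ x, ‖fderiv ℝ u x‖ₑ ^ (2 : ℝ)) ^ (3 / 2 : ℝ) := by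
  set A := ∫⁻ x, ‖u x‖ₑ ^ (2 : ℝ) with hA
  set D := ∫⁻ x, ‖fderiv ℝ u x‖ₑ ^ (2 : ℝ) with hD
  have hmu : Measurable fun x => ‖u x‖ₑ := hu.continuous.measurable.enorm
  have hpq : Real.HolderConjugate (4 : ℝ) (4 / 3 : ℝ) := by
    rw [Real.holderConjugate_iff]; norm_num
  have hhol := ENNReal.lintegral_mul_le_Lp_mul_Lq volume hpq
    (hmu.pow_const (1 / 2 : ℝ)).aemeasurable (hmu.pow_const (5 / 2 : ℝ)).aemeasurable
  calc ∫⁻ x, ‖u x‖ₑ ^ (3 : ℝ)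
      = ∫⁻ x, ((fun x => ‖u x‖ₑ ^ (1 / 2 : ℝ)) * fun x => ‖u x‖ₑ ^ (5 / 2 : ℝ)) x := by
        refine lintegral_congr fun x => ?_
        rw [Pi.mul_apply, ← ENNReal.rpow_add_of_nonneg _ _ (by norm_num) (by norm_num)]
        norm_num
    _ ≤ A ^ (1 / 4 : ℝ) * (∫⁻ x, ‖u x‖ₑ ^ (10 / 3 : ℝ)) ^ (3 / 4 : ℝ) := by
        refine hhol.trans_eq ?_
        simp_rw [← ENNReal.rpow_mul]
        norm_num [hA]
    _ ≤ A ^ (1 / 4 : ℝ) * (ENNReal.ofReal (8 / 3) ^ (5 / 2 : ℝ) * D ^ (5 / 4 : ℝ)) := by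
        gcongr
        exact sobolev_of_hasCompactSupport hu hs
    _ ≤ (A + D) ^ (1 / 4 : ℝ) * (ENNReal.ofReal (8 / 3) ^ (5 / 2 : ℝ) * (A + D) ^ (5 / 4 : ℝ)) := by
        gcongr
        · exact le_self_add
        · exact le_add_self
    _ = _ := by
        rw [mul_left_comm, ← ENNReal.rpow_add_of_nonneg _ _ (by norm_num) (by norm_num)]
        norm_num

/-- Cut-off functions on `ℝ⁵` with uniformly bounded gradients, equal to `1` on growing balls. -/
theorem exists_cutoff : ∃ (c : ℝ≥0) (χ : ℕ → E5 → ℝ), ∀ n, Differentiable ℝ (χ n) ∧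
    HasCompactSupport (χ n) ∧ (∀ x, ‖χ n x‖ₑ ≤ 1) ∧ (∀ x, ‖fderiv ℝ (χ n) x‖ₑ ≤ c) ∧
    ∀ x, ‖x‖ ≤ n → χ n x = 1 := by
  let b : ContDiffBump (0 : E5) := ⟨1, 2, one_pos, one_lt_two⟩
  have hbd : ContDiff ℝ 1 b := b.contDiff
  obtain ⟨c, hc⟩ := (hbd.continuous_fderiv one_ne_zero).bounded_above_of_compact_support
    (b.hasCompactSupport.fderiv (𝕜 := ℝ))
  refine ⟨c.toNNReal, fun n x => b ((n + 1 : ℝ)⁻¹ • x), fun n => ?_⟩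
  have hn : (0 : ℝ) < n + 1 := by positivity
  have hbd' := hbd.differentiable one_ne_zero
  refine ⟨hbd'.comp (differentiable_id.fun_const_smul _),
    b.hasCompactSupport.comp_smul (by positivity), fun x => ?_, fun x => ?_, fun x hx => ?_⟩
  · rw [← ofReal_norm, Real.norm_of_nonneg b.nonneg]
    exact ENNReal.ofReal_le_one.2 b.le_one
  · rw [fderiv_comp_smul, ← ofReal_norm]
    refine ENNReal.ofReal_le_ofReal ?_
    rw [norm_smul, Real.norm_of_nonneg (by positivity)]
    refine (mul_le_of_le_one_left (norm_nonneg _) ?_).trans (hc _)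
    exact inv_le_one_of_one_le₀ (by linarith [n.cast_nonneg (α := ℝ)])
  · refine b.one_of_mem_closedBall ?_
    rw [mem_closedBall_zero_iff, norm_smul, Real.norm_of_nonneg (by positivity),
      inv_mul_le_iff₀ hn]
    change ‖x‖ ≤ (n + 1) * 1
    linarith

/-- The Sobolev embedding `H¹(ℝ⁵) ⊂ L³(ℝ⁵)` for everywhere differentiable functions. -/
theorem exists_lintegral_cube_le : ∃ C : ℝ≥0, ∀ u : E5 → ℂ, Differentiable ℝ u →
    ∫⁻ x, ‖u x‖ₑ ^ (3 : ℝ) ≤ C *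
      ((∫⁻ x, ‖u x‖ₑ ^ (2 : ℝ)) + ∫⁻ x, ‖fderiv ℝ u x‖ₑ ^ (2 : ℝ)) ^ (3 / 2 : ℝ) := by
  obtain ⟨c, χ, hχ⟩ := exists_cutoff
  set B : ℝ≥0∞ := ENNReal.ofReal (8 / 3) ^ (5 / 2 : ℝ) * (2 + 2 * (c : ℝ≥0∞) ^ (2 : ℝ)) ^ (3 / 2 : ℝ)
    with hB
  have hBtop : B ≠ ⊤ := by rw [hB]; finiteness
  refine ⟨B.toNNReal, fun u hu => ?_⟩
  rw [ENNReal.coe_toNNReal hBtop]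
  set A := ∫⁻ x, ‖u x‖ₑ ^ (2 : ℝ) with hA
  set D := ∫⁻ x, ‖fderiv ℝ u x‖ₑ ^ (2 : ℝ) with hD
  have hmu : Measurable fun x => ‖u x‖ₑ := hu.continuous.measurable.enorm
  have hmd : Measurable fun x => ‖fderiv ℝ u x‖ₑ := (measurable_fderiv ℝ u).enorm
  have hcut : ∀ n, ∫⁻ x, ‖χ n x • u x‖ₑ ^ (3 : ℝ) ≤ B * (A + D) ^ (3 / 2 : ℝ) := fun n => by
    obtain ⟨hd, hcs, hle, hgrad, -⟩ := hχ n
    refine (lintegral_cube_le_of_hasCompactSupport (hd.smul hu) hcs.smul_right).trans ?_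
    have hA' : ∫⁻ x, ‖χ n x • u x‖ₑ ^ (2 : ℝ) ≤ A := by
      refine lintegral_mono fun x => ?_
      rw [enorm_smul]
      gcongr
      exact mul_le_of_le_one_left' (hle x)
    have hD' : ∫⁻ x, ‖fderiv ℝ (fun x => χ n x • u x) x‖ₑ ^ (2 : ℝ) ≤
        2 * D + 2 * (c : ℝ≥0∞) ^ (2 : ℝ) * A := by
      calc ∫⁻ x, ‖fderiv ℝ (fun x => χ n x • u x) x‖ₑ ^ (2 : ℝ)
          ≤ ∫⁻ x, (2 * ‖fderiv ℝ u x‖ₑ ^ (2 : ℝ) +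
              2 * (c : ℝ≥0∞) ^ (2 : ℝ) * ‖u x‖ₑ ^ (2 : ℝ)) := by
            refine lintegral_mono fun x => ?_
            have h1 : ‖fderiv ℝ (fun x => χ n x • u x) x‖ₑ ≤ ‖fderiv ℝ u x‖ₑ + c * ‖u x‖ₑ := by
              rw [fderiv_fun_smul (hd x) (hu x)]
              refine (enorm_add_le (χ n x • fderiv ℝ u x) ((fderiv ℝ (χ n) x).smulRight (u x))).trans ?_
              gcongr
              · rw [enorm_smul]
                exact mul_le_of_le_one_left' (hle x)
              · rw [← ofReal_norm, ContinuousLinearMap.norm_smulRight_apply,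
                  ENNReal.ofReal_mul (norm_nonneg _), ofReal_norm, ofReal_norm]
                gcongr
                exact hgrad x
            calc _ ≤ (‖fderiv ℝ u x‖ₑ + c * ‖u x‖ₑ) ^ (2 : ℝ) := by gcongr
              _ ≤ 2 ^ ((2 : ℝ) - 1) * (‖fderiv ℝ u x‖ₑ ^ (2 : ℝ) + (c * ‖u x‖ₑ) ^ (2 : ℝ)) :=
                  ENNReal.rpow_add_le_mul_rpow_add_rpow _ _ (by norm_num)
              _ = _ := by
                  rw [ENNReal.mul_rpow_of_nonneg _ _ (by norm_num), mul_add, ← mul_assoc]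
                  norm_num
        _ = _ := by
            rw [lintegral_add_left ((hmd.pow_const _).const_mul _),
              lintegral_const_mul _ (hmd.pow_const _), lintegral_const_mul _ (hmu.pow_const _)]
    rw [hB, mul_assoc, ← ENNReal.mul_rpow_of_nonneg _ _ (by norm_num)]
    gcongr
    calc _ ≤ A + (2 * D + 2 * (c : ℝ≥0∞) ^ (2 : ℝ) * A) := add_le_add hA' hD'
      _ ≤ (A + (2 * D + 2 * (c : ℝ≥0∞) ^ (2 : ℝ) * A)) +
          (A + 2 * (c : ℝ≥0∞) ^ (2 : ℝ) * D) := le_self_add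
      _ = _ := by ring
  have hlim : ∀ x, Tendsto (fun n => ‖χ n x • u x‖ₑ ^ (3 : ℝ)) atTop (nhds (‖u x‖ₑ ^ (3 : ℝ))) := by
    intro x
    obtain ⟨N, hN⟩ := exists_nat_ge ‖x‖
    refine tendsto_const_nhds.congr' ?_
    filter_upwards [eventually_ge_atTop N] with n hn
    rw [(hχ n).2.2.2.2 x (hN.trans (by exact_mod_cast hn)), one_smul]
  calc ∫⁻ x, ‖u x‖ₑ ^ (3 : ℝ)
      = ∫⁻ x, liminf (fun n => ‖χ n x • u x‖ₑ ^ (3 : ℝ)) atTop :=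
        lintegral_congr fun x => (hlim x).liminf_eq.symm
    _ ≤ liminf (fun n => ∫⁻ x, ‖χ n x • u x‖ₑ ^ (3 : ℝ)) atTop :=
        lintegral_liminf_le fun n =>
          ((hχ n).1.continuous.smul hu.continuous).measurable.enorm.pow_const _
    _ ≤ _ := liminf_le_of_frequently_le' (.of_forall hcut)

theorem lintegral_enorm_sq_eq_ofReal_integral {F : Type*} [NormedAddCommGroup F] {f : E5 → F}
    (hf : MemLp f 2 volume) :
    ∫⁻ x, ‖f x‖ₑ ^ (2 : ℝ) = ENNReal.ofReal (∫ x, ‖f x‖ ^ 2) := by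
  rw [ofReal_integral_eq_lintegral_ofReal (by simpa using hf.integrable_norm_pow two_ne_zero)
    (ae_of_all _ fun x => by positivity)]
  refine lintegral_congr fun x => ?_
  rw [ENNReal.ofReal_pow (norm_nonneg _), ofReal_norm]
  norm_cast

theorem H1normSq_nonneg (u : E5 → ℂ) : 0 ≤ H1normSq u := by
  unfold H1normSq; positivity

theorem H1normSq_pos {u : E5 → ℂ} (hu : InH1 u) (h0 : u ≠ 0) : 0 < H1normSq u := by
  have hgrad : 0 ≤ ∫ x : E5, ‖fderiv ℝ u x‖ ^ 2 := by positivity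
  suffices 0 < ∫ x : E5, ‖u x‖ ^ 2 by unfold H1normSq; linarith
  have hint : Integrable fun x => ‖u x‖ ^ 2 := by
    simpa using hu.1.integrable_norm_pow two_ne_zero
  refine lt_of_le_of_ne (by positivity) fun h => h0 ?_
  have hae := (integral_eq_zero_iff_of_nonneg (fun x => by positivity) hint).1 h.symm
  have hall := (hu.2.1.continuous.norm.pow 2).ae_eq_iff_eq volume continuous_zero |>.1 hae
  funext x
  simpa using congrFun hall x

theorem exists_Pot_le : ∃ C : ℝ, 0 < C ∧ ∀ u v : E5 → ℂ, InH1 u → InH1 v →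
    Pot u v ≤ C * (H1normSq u + H1normSq v) ^ (3 / 2 : ℝ) := by
  obtain ⟨C, hC⟩ := exists_lintegral_cube_le
  have hcube : ∀ u, InH1 u → ∫⁻ x, ‖u x‖ₑ ^ (3 : ℝ) ≤
      ENNReal.ofReal (C * H1normSq u ^ (3 / 2 : ℝ)) := fun u hu => by
    refine (hC u hu.2.1).trans_eq ?_
    rw [lintegral_enorm_sq_eq_ofReal_integral hu.1, lintegral_enorm_sq_eq_ofReal_integral hu.2.2,
      ← ENNReal.ofReal_add (by positivity) (by positivity),
      ENNReal.ofReal_rpow_of_nonneg (by positivity) (by norm_num),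
      ENNReal.ofReal_mul (by positivity), ENNReal.ofReal_coe_nnreal]
    rfl
  refine ⟨2 * C + 1, by positivity, fun u v hu hv => ?_⟩
  have hu0 := H1normSq_nonneg u
  have hv0 := H1normSq_nonneg v
  set N := H1normSq u + H1normSq v with hN
  have hN0 : 0 ≤ N ^ (3 / 2 : ℝ) := by positivity
  have hPot : ENNReal.ofReal (Pot u v) ≤ ENNReal.ofReal (2 * C * N ^ (3 / 2 : ℝ)) := by
    calc ENNReal.ofReal (Pot u v)
        ≤ ‖Pot u v‖ₑ := Real.ofReal_le_enorm _
      _ ≤ ∫⁻ x, ‖((starRingEnd ℂ) (v x) * (u x) ^ 2).re‖ₑ := enorm_integral_le_lintegral_enorm _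
      _ ≤ ∫⁻ x, (‖u x‖ₑ ^ (3 : ℝ) + ‖v x‖ₑ ^ (3 : ℝ)) := by
          refine lintegral_mono fun x => ?_
          calc ‖((starRingEnd ℂ) (v x) * (u x) ^ 2).re‖ₑ
              ≤ ‖(starRingEnd ℂ) (v x) * (u x) ^ 2‖ₑ := by
                rw [← ofReal_norm, ← ofReal_norm]
                exact ENNReal.ofReal_le_ofReal (Complex.abs_re_le_norm _)
            _ = ‖v x‖ₑ * ‖u x‖ₑ ^ 2 := by
                rw [enorm_mul, enorm_pow, ← ofReal_norm, RCLike.norm_conj, ofReal_norm]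
            _ ≤ max ‖u x‖ₑ ‖v x‖ₑ * max ‖u x‖ₑ ‖v x‖ₑ ^ 2 := by
                gcongr
                · exact le_max_right _ _
                · exact le_max_left _ _
            _ = max ‖u x‖ₑ ‖v x‖ₑ ^ (3 : ℝ) := by norm_cast; ring
            _ ≤ _ := by
                rcases max_choice ‖u x‖ₑ ‖v x‖ₑ with h | h <;> rw [h]
                · exact le_self_add
                · exact le_add_self
      _ = (∫⁻ x, ‖u x‖ₑ ^ (3 : ℝ)) + ∫⁻ x, ‖v x‖ₑ ^ (3 : ℝ) :=
          lintegral_add_left (hu.2.1.continuous.measurable.enorm.pow_const _) _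
      _ ≤ ENNReal.ofReal (C * N ^ (3 / 2 : ℝ)) + ENNReal.ofReal (C * N ^ (3 / 2 : ℝ)) := by
          refine add_le_add ((hcube u hu).trans ?_) ((hcube v hv).trans ?_) <;> gcongr <;> linarith
      _ = _ := by
          rw [← ENNReal.ofReal_add (by positivity) (by positivity)]
          ring_nf
  have := (ENNReal.ofReal_le_ofReal_iff (by positivity)).1 hPot
  linarith

/-- Uniform positive lower bound for `P` on the Nehari manifold: there is
`C > 0` such that every nontrivial `(u,v)` with `K_ω(u,v) = 0` satisfies
`P(u,v) ≥ √(1/C) > 0`. -/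
theorem Pot_lower_bound_on_Nehari (ω : ℝ) (hω : 0 < ω) :
    ∃ C : ℝ, 0 < C ∧ 0 < Real.sqrt (1 / C) ∧
      ∀ u v : E5 → ℂ, InH1 u → InH1 v → Nontriv2 u v → Nehari ω u v = 0 →
        Real.sqrt (1 / C) ≤ Pot u v := by
  obtain ⟨C, hC, hPot⟩ := exists_Pot_le
  set m := min (1 / 2) ω with hm
  have hm0 : 0 < m := lt_min (by norm_num) hω
  have hm1 : m ≤ 1 / 2 := min_le_left _ _
  have hm2 : m ≤ ω := min_le_right _ _
  set δ := m / 3 * (m / (3 * C)) ^ 2 with hδ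
  have hδ0 : 0 < δ := by positivity
  have hsqrt : Real.sqrt (1 / (1 / δ ^ 2)) = δ := by
    rw [one_div_one_div, Real.sqrt_sq hδ0.le]
  refine ⟨1 / δ ^ 2, by positivity, by rwa [hsqrt], fun u v hu hv hnt hN => ?_⟩
  rw [hsqrt]
  have hpos : 0 < H1normSq u + H1normSq v := by
    by_cases h0 : u = 0
    · exact add_pos_of_nonneg_of_pos (H1normSq_nonneg u)
        (H1normSq_pos hv fun h => hnt ⟨h0, h⟩)
    · exact add_pos_of_pos_of_nonneg (H1normSq_pos hu h0) (H1normSq_nonneg v)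
  have hle := hPot u v hu hv
  have hcoer : m * (H1normSq u + H1normSq v) ≤ 3 * Pot u v := by
    have h1 : 0 ≤ ∫ x : E5, ‖u x‖ ^ 2 := by positivity
    have h2 : 0 ≤ ∫ x : E5, ‖v x‖ ^ 2 := by positivity
    have h3 : 0 ≤ ∫ x : E5, ‖fderiv ℝ u x‖ ^ 2 := by positivity
    have h4 : 0 ≤ ∫ x : E5, ‖fderiv ℝ v x‖ ^ 2 := by positivity
    unfold Nehari Kin Mass at hN
    unfold H1normSq
    nlinarith
  set N := H1normSq u + H1normSq v with hNdef
  have hN32 : N ^ (3 / 2 : ℝ) = N * Real.sqrt N := by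
    rw [Real.sqrt_eq_rpow, ← Real.rpow_one_add' hpos.le (by norm_num)]
    norm_num
  rw [hN32] at hle
  have hroot : m / (3 * C) ≤ Real.sqrt N := by
    rw [div_le_iff₀ (by positivity)]
    refine le_of_mul_le_mul_left ?_ hpos
    linarith
  have hsq : (m / (3 * C)) ^ 2 ≤ N := by
    calc (m / (3 * C)) ^ 2 ≤ Real.sqrt N ^ 2 := by gcongr
      _ = N := Real.sq_sqrt hpos.le
  calc δ ≤ m / 3 * N := by rw [hδ]; gcongr
    _ ≤ Pot u v := by linarith
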